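/- arXiv:2004.11988 — 2 statements merged into one kernel-verified Lean document; each statement's English description precedes it below -/
import Mathlib

section
/- Let M = (S, A, →, s₀, AP, L) be a finite action-deterministic transition system without terminal states, and let ample : S → Set A satisfy: (C1) ∅ ≠ ample(s) ⊆ A(s) for all s; (C2) for every execution fragment s →α₁ s₁ →α₂ … →αₙ sₙ →β t of M with β ∉ ample(s) such that β depends on (is not independent of) some action of ample(s), some αᵢ (1 ≤ i ≤ n) belongs to ample(s); (C3) if ample(s) ≠ A(s) then every α ∈ ample(s) is invisible; (C4) every cycle in the reduced system M^ample contains a state s with ample(s) = A(s). Then for each path of M there exists a stutter-trace-equivalent path of M^ample, and for each path of M^ample there exists a stutter-trace-equivalent path of M. -/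
/-!
STATEMENT 0: Correctness of partial order reduction (Theorem 1 of the paper).
-/

section

variable {S A P : Type}

/-- A transition system with state space `S`, actions `A`, atomic propositions `P`. -/
structure TS (S A P : Type) where
  step : S → A → S → Prop
  init : S
  label : S → Set P

namespace TS

variable (M : TS S A P)

/-- Action `a` is enabled in state `s`. -/
def Enabled (s : S) (a : A) : Prop := ∃ s', M.step s a s'

/-- Action-determinism: each action has at most one successor in each state. -/
def ActionDeterministic : Prop :=
  ∀ s a s₁ s₂, M.step s a s₁ → M.step s a s₂ → s₁ = s₂

/-- A state reachable from the initial state. -/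
def Reachable (s : S) : Prop :=
  Relation.ReflTransGen (fun x y => ∃ a, M.step x a y) M.init s

/-- No terminal states: every reachable state has some enabled action. -/
def NoTerminal : Prop := ∀ s, M.Reachable s → ∃ a, M.Enabled s a

/-- Two (distinct) actions are independent: in every state where both are enabled,
each remains enabled after the other, and both execution orders lead to the same
state. -/
def Independent (a b : A) : Prop :=
  a ≠ b ∧ ∀ s s₁ s₂, M.step s a s₁ → M.step s b s₂ →
    M.Enabled s₂ a ∧ M.Enabled s₁ b ∧
    ∀ t₁ t₂, M.step s₁ b t₁ → M.step s₂ a t₂ → t₁ = t₂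

/-- `b` depends on a set of actions if it is not independent of some action in it. -/
def DependsOn (b : A) (T : Set A) : Prop := ∃ a ∈ T, ¬ M.Independent a b

/-- An invisible action never changes the labelling. -/
def Invisible (a : A) : Prop := ∀ s s', M.step s a s' → M.label s = M.label s'

/-- An (initial) infinite path of the transition system. -/
def IsPath (π : ℕ → S) : Prop :=
  π 0 = M.init ∧ ∀ n, ∃ a, M.step (π n) a (π (n + 1))

/-- The trace of a path. -/
def trace (π : ℕ → S) : ℕ → Set P := fun n => M.label (π n)

end TS

/-- Transitions of the reduced system `M^ample`. -/
def reducedStep (M : TS S A P) (ample : S → Set A) (s : S) (a : A) (s' : S) : Prop :=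
  M.step s a s' ∧ a ∈ ample s

/-- States of the reduced system: reachable from the initial state under reduced
transitions. -/
def ReachableR (M : TS S A P) (ample : S → Set A) (s : S) : Prop :=
  Relation.ReflTransGen (fun x y => ∃ a, reducedStep M ample x a y) M.init s

/-- An (initial) infinite path of the reduced system. -/
def IsRPath (M : TS S A P) (ample : S → Set A) (π : ℕ → S) : Prop :=
  π 0 = M.init ∧ ∀ n, ∃ a, reducedStep M ample (π n) a (π (n + 1))

/-- Stutter equivalence of infinite traces (à la Baier–Katoen): there are two
strictly increasing sequences of block boundaries starting at 0 such that all
letters within corresponding blocks agree. -/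
def StutterEquiv (σ σ' : ℕ → Set P) : Prop :=
  ∃ i j : ℕ → ℕ, i 0 = 0 ∧ j 0 = 0 ∧ StrictMono i ∧ StrictMono j ∧
    ∀ k : ℕ, ∀ m, i k ≤ m → m < i (k + 1) → ∀ n, j k ≤ n → n < j (k + 1) → σ m = σ' n

/-- A position map `p` into `σ` that reproduces `τ`, moves forward infinitely often, and jumps
only over letters that repeat the current one witnesses stutter equivalence. -/
theorem stutterEquiv_of_position {σ τ : ℕ → Set P} (p : ℕ → ℕ) (hp : p 0 = 0)
    (hτ : ∀ k, τ k = σ (p k))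
    (hstep : ∀ k, p (k + 1) = p k ∨
      (p k < p (k + 1) ∧ ∀ m, p k ≤ m → m < p (k + 1) → σ m = σ (p k)))
    (hinf : ∀ K, ∃ k, K ≤ k ∧ p (k + 1) ≠ p k) :
    StutterEquiv σ τ := by
  have hnext : ∀ K, ∃ N, K ≤ N ∧ p (N + 1) ≠ p N ∧ ∀ k, K ≤ k → k ≤ N → p k = p K := by
    classical
    intro K
    obtain ⟨hK, hne⟩ := Nat.find_spec (hinf K)
    refine ⟨Nat.find (hinf K), hK, hne, fun k hk => ?_⟩
    induction k, hk using Nat.le_induction with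
    | base => exact fun _ => rfl
    | succ k hk ih =>
      intro hlt
      have hmin := Nat.find_min (hinf K) (m := k) (by omega)
      push Not at hmin
      rw [hmin hk, ih (by omega)]
  choose N hN hne hconst using hnext
  let j : ℕ → ℕ := fun t => Nat.rec 0 (fun _ K => N K + 1) t
  have hj : ∀ t, j (t + 1) = N (j t) + 1 := fun _ => rfl
  have hblock : ∀ t, p (j t) < p (j (t + 1)) ∧
      ∀ m, p (j t) ≤ m → m < p (j (t + 1)) → σ m = σ (p (j t)) := by
    intro t
    have h := (hstep (N (j t))).resolve_left (hne (j t))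
    rwa [hconst (j t) (N (j t)) (hN _) le_rfl, ← hj] at h
  refine ⟨fun t => p (j t), j, hp, rfl, strictMono_nat_of_lt_succ fun t => (hblock t).1,
    strictMono_nat_of_lt_succ fun t => ?_, fun t m hm hm' n hn hn' => ?_⟩
  · rw [hj]
    exact Nat.lt_succ_of_le (hN _)
  · rw [hj] at hn'
    rw [(hblock t).2 m hm hm', hτ, hconst (j t) n hn (by omega)]

theorem StutterEquiv.refl (σ : ℕ → Set P) : StutterEquiv σ σ :=
  ⟨id, id, rfl, rfl, strictMono_id, strictMono_id, fun k m hm hm' n hn hn' => by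
    simp only [id] at hm hm' hn hn'
    congr 1
    omega⟩

/-- An infinite execution of `M` whose trace is obtained from `σ` by sampling it at the positions
`pos`, skipping only letters that repeat the last sampled one. -/
structure SampledRun (M : TS S A P) (σ : ℕ → Set P) where
  state : ℕ → S
  act : ℕ → A
  pos : ℕ → ℕ
  step : ∀ n, M.step (state n) (act n) (state (n + 1))
  pos_lt : ∀ n, pos n < pos (n + 1)
  label : ∀ n, M.label (state n) = σ (pos n)
  skip : ∀ n m, pos n ≤ m → m < pos (n + 1) → σ m = σ (pos n)

/-- One reduced transition from the first state of `X` to the first state of `Y`, which either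
consumes the first step of `X` or postpones it. -/
def SampledRun.Next {M : TS S A P} {σ : ℕ → Set P} (ample : S → Set A)
    (X Y : SampledRun M σ) : Prop :=
  (∃ a, reducedStep M ample (X.state 0) a (Y.state 0)) ∧
    (Y.pos 0 = X.pos 1 ∨
      Y.pos 0 = X.pos 0 ∧ X.act 0 ∉ ample (X.state 0))

/-- An ample action stays enabled along a run avoiding the ample set, and the run can be
replayed after it. -/
theorem exists_commuted_run {M : TS S A P} {ample : S → Set A}
    (hC2 : ∀ (s : S) (n : ℕ) (c : ℕ → S) (acts : ℕ → A) (β : A) (t : S),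
      c 0 = s → (∀ i < n, M.step (c i) (acts i) (c (i + 1))) →
      M.step (c n) β t → β ∉ ample s → M.DependsOn β (ample s) →
      ∃ i < n, acts i ∈ ample s)
    {c : ℕ → S} {acts : ℕ → A} (hc : ∀ n, M.step (c n) (acts n) (c (n + 1)))
    {α : A} (hα : α ∈ ample (c 0)) (hen : M.Enabled (c 0) α) :
    ∃ c' : ℕ → S, ∀ n, (∀ i < n, acts i ∉ ample (c 0)) →
      M.step (c n) α (c' n) ∧ ∀ i < n, M.step (c' i) (acts i) (c' (i + 1)) := by
  have hind : ∀ n, (∀ i < n + 1, acts i ∉ ample (c 0)) → M.Independent α (acts n) := by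
    intro n hn
    by_contra hdep
    obtain ⟨i, hi, hmem⟩ := hC2 (c 0) n c acts (acts n) (c (n + 1)) rfl (fun i _ => hc i) (hc n)
      (hn n n.lt_succ_self) ⟨α, hα, hdep⟩
    exact hn i (by omega) hmem
  have henabled : ∀ n, (∀ i < n, acts i ∉ ample (c 0)) → M.Enabled (c n) α := by
    intro n
    induction n with
    | zero => exact fun _ => hen
    | succ n ih =>
      intro hn
      obtain ⟨s', hs'⟩ := ih fun i hi => hn i (by omega)
      exact ((hind n hn).2 _ _ _ hs' (hc n)).1
  have hsucc : ∀ n, ∃ s', (∀ i < n, acts i ∉ ample (c 0)) → M.step (c n) α s' := by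
    intro n
    by_cases hn : ∀ i < n, acts i ∉ ample (c 0)
    · exact (henabled n hn).imp fun _ h _ => h
    · exact ⟨c n, fun h => absurd h hn⟩
  choose c' hc' using hsucc
  refine ⟨c', fun n hn => ⟨hc' n hn, fun i hi => ?_⟩⟩
  have h₀ := hc' i fun k hk => hn k (by omega)
  have h₁ := hc' (i + 1) fun k hk => hn k (by omega)
  obtain ⟨-, ⟨t, ht⟩, hcomm⟩ :=
    (hind i fun k hk => hn k (by omega)).2 _ _ _ h₀ (hc i)
  rwa [← hcomm t _ ht h₁]

theorem SampledRun.exists_next {M : TS S A P} {ample : S → Set A} {σ : ℕ → Set P}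
    (hdet : M.ActionDeterministic)
    (hC1 : ∀ s : S, (ample s).Nonempty ∧ ample s ⊆ {a | M.Enabled s a})
    (hC2 : ∀ (s : S) (n : ℕ) (c : ℕ → S) (acts : ℕ → A) (β : A) (t : S),
      c 0 = s → (∀ i < n, M.step (c i) (acts i) (c (i + 1))) →
      M.step (c n) β t → β ∉ ample s → M.DependsOn β (ample s) →
      ∃ i < n, acts i ∈ ample s)
    (hC3 : ∀ s : S, ample s ≠ {a | M.Enabled s a} → ∀ a ∈ ample s, M.Invisible a)
    (X : SampledRun M σ) : ∃ Y : SampledRun M σ, X.Next ample Y := by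
  classical
  by_cases hfirst : X.act 0 ∈ ample (X.state 0)
  · exact ⟨⟨fun n => X.state (n + 1), fun n => X.act (n + 1), fun n => X.pos (n + 1),
      fun n => X.step _, fun n => X.pos_lt _, fun n => X.label _, fun n => X.skip _⟩,
      ⟨_, X.step 0, hfirst⟩, Or.inl rfl⟩
  have hinv : ∀ a ∈ ample (X.state 0), M.Invisible a :=
    hC3 _ fun h => hfirst (h ▸ (⟨_, X.step 0⟩ : M.Enabled (X.state 0) (X.act 0)))
  by_cases hsome : ∃ i, X.act i ∈ ample (X.state 0)
  · obtain ⟨i, hi, hmin⟩ : ∃ i, X.act i ∈ ample (X.state 0) ∧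
        ∀ k < i, X.act k ∉ ample (X.state 0) :=
      ⟨Nat.find hsome, Nat.find_spec hsome, fun k hk => Nat.find_min hsome hk⟩
    obtain ⟨c', hc'⟩ := exists_commuted_run hC2 X.step hi ((hC1 _).2 hi)
    have hα : ∀ n ≤ i, M.step (X.state n) (X.act i) (c' n) := fun n hn =>
      (hc' n fun k hk => hmin k (by omega)).1
    have hjoin : c' i = X.state (i + 1) := hdet _ _ _ _ (hα i le_rfl) (X.step i)
    have hlabel : ∀ n ≤ i, M.label (c' n) = M.label (X.state n) := fun n hn =>
      (hinv _ hi _ _ (hα n hn)).symm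
    have hrepeat : σ (X.pos (i + 1)) = σ (X.pos i) := by
      rw [← X.label, ← X.label, ← hjoin, hlabel i le_rfl]
    refine ⟨⟨fun n => if n ≤ i then c' n else X.state (n + 1),
      fun n => if n < i then X.act n else X.act (n + 1),
      fun n => if n ≤ i then X.pos n else X.pos (n + 1), fun n => ?_, fun n => ?_, fun n => ?_,
      fun n m hm hm' => ?_⟩, ⟨X.act i, ?_, hi⟩, Or.inr ⟨?_, hfirst⟩⟩
    · rcases lt_trichotomy n i with h | rfl | h
      · simpa [h, h.le, Nat.succ_le_of_lt h] using (hc' i hmin).2 n h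
      · simpa [hjoin] using X.step (n + 1)
      · simpa [show ¬ n ≤ i by omega, show ¬ n < i by omega, show ¬ n + 1 ≤ i by omega]
          using X.step (n + 1)
    · have h₀ := X.pos_lt n
      have h₁ := X.pos_lt (n + 1)
      split_ifs <;> omega
    · split_ifs with h
      · rw [hlabel n h, X.label]
      · exact X.label _
    · rcases lt_trichotomy n i with h | rfl | h
      · simp only [h.le, Nat.succ_le_of_lt h, if_true] at hm hm' ⊢
        exact X.skip n m hm hm'
      · simp only [le_refl, if_true, show ¬ n + 1 ≤ n by omega, if_false] at hm hm' ⊢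
        rcases lt_or_ge m (X.pos (n + 1)) with hlt | hge
        · exact X.skip n m hm hlt
        · rw [X.skip (n + 1) m hge hm', hrepeat]
      · simp only [show ¬ n ≤ i by omega, show ¬ n + 1 ≤ i by omega, if_false] at hm hm' ⊢
        exact X.skip (n + 1) m hm hm'
    · simpa using hα 0 (Nat.zero_le i)
    · simp
  · push Not at hsome
    obtain ⟨α, hα⟩ := (hC1 (X.state 0)).1
    obtain ⟨c', hc'⟩ := exists_commuted_run hC2 X.step hα ((hC1 _).2 hα)
    have hαstep : ∀ n, M.step (X.state n) α (c' n) := fun n => (hc' n fun k _ => hsome k).1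
    exact ⟨⟨c', X.act, X.pos, fun n => (hc' (n + 1) fun k _ => hsome k).2 n n.lt_succ_self,
      X.pos_lt, fun n => by rw [← hinv α hα _ _ (hαstep n), X.label], X.skip⟩,
      ⟨α, hαstep 0, hα⟩, Or.inr ⟨rfl, hfirst⟩⟩

theorem reachableR_of_isRPath {M : TS S A P} {ample : S → Set A} {π : ℕ → S}
    (hπ : IsRPath M ample π) (n : ℕ) : ReachableR M ample (π n) := by
  induction n with
  | zero => exact hπ.1 ▸ Relation.ReflTransGen.refl
  | succ n ih => exact ih.tail (hπ.2 n)

/-- Under the cycle condition, a path of a finite reduced system visits fully expanded states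
infinitely often. -/
theorem exists_fully_expanded [Finite S] {M : TS S A P} {ample : S → Set A}
    (hC4 : ∀ (n : ℕ) (c : ℕ → S) (acts : ℕ → A), 1 ≤ n →
      ReachableR M ample (c 0) → c n = c 0 →
      (∀ i < n, reducedStep M ample (c i) (acts i) (c (i + 1))) →
      ∃ i < n, ample (c i) = {a | M.Enabled (c i) a})
    {π : ℕ → S} (hπ : IsRPath M ample π) (K : ℕ) :
    ∃ k, K ≤ k ∧ ample (π k) = {a | M.Enabled (π k) a} := by
  obtain ⟨x, y, hxy, heq⟩ : ∃ x y, x < y ∧ π (K + x) = π (K + y) := by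
    obtain ⟨x, y, hne, heq⟩ := Finite.exists_ne_map_eq_of_infinite fun n => π (K + n)
    rcases hne.lt_or_gt with h | h
    · exact ⟨x, y, h, heq⟩
    · exact ⟨y, x, h, heq.symm⟩
  choose a ha using hπ.2
  obtain ⟨i, -, hi⟩ := hC4 (y - x) (fun n => π (K + x + n)) (fun n => a (K + x + n)) (by omega)
    (reachableR_of_isRPath hπ _)
    (by rw [show K + x + (y - x) = K + y by omega, ← heq, Nat.add_zero])
    (fun i _ => ha _)
  exact ⟨K + x + i, by omega, hi⟩

/-- **Correctness of POR.**  For a finite action-deterministic transition system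
without terminal states and an ample function satisfying (C1)–(C4), each path of `M`
has a stutter-trace-equivalent path in `M^ample` and vice versa. -/
theorem por_correctness [Finite S] [Finite A]
    (M : TS S A P) (ample : S → Set A)
    (hdet : M.ActionDeterministic) (hnt : M.NoTerminal)
    -- (C1) nonemptiness
    (hC1 : ∀ s : S, (ample s).Nonempty ∧ ample s ⊆ {a | M.Enabled s a})
    -- (C2) dependency
    (hC2 : ∀ (s : S) (n : ℕ) (c : ℕ → S) (acts : ℕ → A) (β : A) (t : S),
      c 0 = s → (∀ i < n, M.step (c i) (acts i) (c (i + 1))) →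
      M.step (c n) β t → β ∉ ample s → M.DependsOn β (ample s) →
      ∃ i < n, acts i ∈ ample s)
    -- (C3) invisibility
    (hC3 : ∀ s : S, ample s ≠ {a | M.Enabled s a} → ∀ a ∈ ample s, M.Invisible a)
    -- (C4) cycle condition: every cycle of the reduced system contains a fully
    -- expanded state
    (hC4 : ∀ (n : ℕ) (c : ℕ → S) (acts : ℕ → A), 1 ≤ n →
      ReachableR M ample (c 0) → c n = c 0 →
      (∀ i < n, reducedStep M ample (c i) (acts i) (c (i + 1))) →
      ∃ i < n, ample (c i) = {a | M.Enabled (c i) a}) :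
    (∀ π : ℕ → S, M.IsPath π → ∃ π' : ℕ → S, IsRPath M ample π' ∧
      StutterEquiv (M.trace π) (M.trace π')) ∧
    (∀ π' : ℕ → S, IsRPath M ample π' → ∃ π : ℕ → S, M.IsPath π ∧
      StutterEquiv (M.trace π') (M.trace π)) := by
  refine ⟨fun π hπ => ?_, fun π hπ => ⟨π, ⟨hπ.1, fun n => ?_⟩, StutterEquiv.refl _⟩⟩
  · obtain ⟨h0, hstep⟩ := hπ
    choose a ha using hstep
    let X₀ : SampledRun M (M.trace π) :=
      ⟨π, a, id, ha, Nat.lt_succ_self, fun _ => rfl, fun n m hm hm' => by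
        simp only [id] at hm hm'
        rw [show m = n by omega, id]⟩
    choose next hnext using
      fun X : SampledRun M (M.trace π) => X.exists_next hdet hC1 hC2 hC3
    let X : ℕ → SampledRun M (M.trace π) := fun k => next^[k] X₀
    have hX : ∀ k, (X k).Next ample (X (k + 1)) := fun k => by
      simpa only [X, Function.iterate_succ_apply'] using hnext (X k)
    have hpath : IsRPath M ample fun k => (X k).state 0 := ⟨h0, fun k => (hX k).1⟩
    refine ⟨_, hpath, stutterEquiv_of_position (fun k => (X k).pos 0) rfl
      (fun k => (X k).label 0) (fun k => ?_) fun K => ?_⟩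
    · rcases (hX k).2 with h | h
      · exact Or.inr (by simpa only [h] using ⟨(X k).pos_lt 0, (X k).skip 0⟩)
      · exact Or.inl h.1
    · obtain ⟨k, hk, hfull⟩ := exists_fully_expanded hC4 hpath K
      have hmem : (X k).act 0 ∈ ample ((X k).state 0) :=
        hfull ▸ (⟨_, (X k).step 0⟩ : M.Enabled _ _)
      have hadv := (hX k).2.resolve_right fun h => h.2 hmem
      exact ⟨k, hk, by simpa only [hadv] using ((X k).pos_lt 0).ne'⟩
  · obtain ⟨a, ha, -⟩ := hπ.2 n
    exact ⟨a, ha⟩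

end
end

section
/- If σ and σ' are stutter-equivalent infinite traces over 2^AP and φ is an LTL formula over AP that does not contain the next-step operator ◯, then σ satisfies φ if and only if σ' satisfies φ. -/
/-!
STATEMENT 1: LTL without the next-step operator is invariant under stutter
equivalence of infinite traces.
-/

section

variable {P : Type}

/-- LTL formulas without the next-step operator ◯: atomic propositions, Boolean
connectives and until (from which ◇ and □ are derivable). -/
inductive LTL (P : Type) where
  | atom : P → LTL P
  | tt : LTL P
  | neg : LTL P → LTL P
  | and : LTL P → LTL P → LTL P
  | until_ : LTL P → LTL P → LTL P

/-- Standard LTL satisfaction on infinite traces. -/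
def LTL.Sat : LTL P → (ℕ → Set P) → Prop
  | .atom p, σ => p ∈ σ 0
  | .tt, _ => True
  | .neg φ, σ => ¬ LTL.Sat φ σ
  | .and φ ψ, σ => LTL.Sat φ σ ∧ LTL.Sat ψ σ
  | .until_ φ ψ, σ =>
      ∃ n : ℕ, LTL.Sat ψ (fun k => σ (k + n)) ∧
        ∀ m < n, LTL.Sat φ (fun k => σ (k + m))

/-- The block starts `i 0 = 0 < i 1 < i 2 < ⋯` cover `ℕ`. -/
theorem exists_block_mem {i : ℕ → ℕ} (h0 : i 0 = 0) (hi : StrictMono i) (m : ℕ) :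
    ∃ k, i k ≤ m ∧ m < i (k + 1) := by
  induction m with
  | zero => exact ⟨0, h0.le, h0.symm.trans_lt (hi Nat.zero_lt_one)⟩
  | succ m ih =>
    obtain ⟨k, hk, hk'⟩ := ih
    rcases Nat.lt_or_ge (m + 1) (i (k + 1)) with h | h
    · exact ⟨k, by omega, h⟩
    · have := hi (Nat.lt_succ_self (k + 1))
      exact ⟨k + 1, h, by simp only [Nat.succ_eq_add_one] at this; omega⟩

/-- Block boundaries of the suffix starting at `m`, a position in block `k`. -/
def suffixBlocks (i : ℕ → ℕ) (k m : ℕ) : ℕ → ℕ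
  | 0 => 0
  | l + 1 => i (k + l + 1) - m

theorem strictMono_suffixBlocks {i : ℕ → ℕ} (hi : StrictMono i) {k m : ℕ}
    (hm : m < i (k + 1)) : StrictMono (suffixBlocks i k m) := by
  refine strictMono_nat_of_lt_succ fun l => ?_
  cases l with
  | zero => simpa [suffixBlocks] using hm
  | succ l =>
    have h₁ : i (k + 1) ≤ i (k + l + 1) := hi.monotone (by omega)
    have h₂ : i (k + l + 1) < i (k + (l + 1) + 1) := hi (by omega)
    simp only [suffixBlocks]
    omega

theorem suffixBlocks_bounds {i : ℕ → ℕ} {k m l a : ℕ} (hm : i k ≤ m)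
    (h : suffixBlocks i k m l ≤ a) (h' : a < suffixBlocks i k m (l + 1)) :
    i (k + l) ≤ a + m ∧ a + m < i (k + l + 1) := by
  cases l <;> simp only [suffixBlocks, Nat.add_zero, ← Nat.add_assoc] at * <;> omega

/-- Suffixes starting in corresponding blocks are stutter equivalent. -/
theorem stutterEquiv_suffix {σ σ' : ℕ → Set P} {i j : ℕ → ℕ} (hi : StrictMono i)
    (hj : StrictMono j)
    (h : ∀ k : ℕ, ∀ m, i k ≤ m → m < i (k + 1) → ∀ n, j k ≤ n → n < j (k + 1) → σ m = σ' n)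
    {k m n : ℕ} (hm : i k ≤ m) (hm' : m < i (k + 1)) (hn : j k ≤ n) (hn' : n < j (k + 1)) :
    StutterEquiv (fun t => σ (t + m)) (fun t => σ' (t + n)) := by
  refine ⟨suffixBlocks i k m, suffixBlocks j k n, rfl, rfl, strictMono_suffixBlocks hi hm',
    strictMono_suffixBlocks hj hn', fun l a ha ha' b hb hb' => ?_⟩
  obtain ⟨h₁, h₂⟩ := suffixBlocks_bounds hm ha ha'
  obtain ⟨h₃, h₄⟩ := suffixBlocks_bounds hn hb hb'
  exact h (k + l) _ h₁ h₂ _ h₃ h₄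

theorem StutterEquiv.symm {σ σ' : ℕ → Set P} (h : StutterEquiv σ σ') : StutterEquiv σ' σ := by
  obtain ⟨i, j, hi0, hj0, hi, hj, h⟩ := h
  exact ⟨j, i, hj0, hi0, hj, hi, fun k m hm hm' n hn hn' => (h k n hn hn' m hm hm').symm⟩

theorem StutterEquiv.apply_zero {σ σ' : ℕ → Set P} (h : StutterEquiv σ σ') : σ 0 = σ' 0 := by
  obtain ⟨i, j, hi0, hj0, hi, hj, h⟩ := h
  exact h 0 0 hi0.le (hi0.symm.trans_lt (hi Nat.zero_lt_one)) 0
    hj0.le (hj0.symm.trans_lt (hj Nat.zero_lt_one))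

/-- Every position of `σ` is matched by a position of `σ'` with a stutter-equivalent suffix, all
earlier positions of `σ'` being matched by earlier positions of `σ`. -/
theorem StutterEquiv.exists_match {σ σ' : ℕ → Set P} (h : StutterEquiv σ σ') (n : ℕ) :
    ∃ n', StutterEquiv (fun t => σ (t + n)) (fun t => σ' (t + n')) ∧
      ∀ m' < n', ∃ m < n, StutterEquiv (fun t => σ (t + m)) (fun t => σ' (t + m')) := by
  obtain ⟨i, j, hi0, hj0, hi, hj, h⟩ := h
  obtain ⟨k, hk, hk'⟩ := exists_block_mem hi0 hi n
  refine ⟨j k, stutterEquiv_suffix hi hj h hk hk' le_rfl (hj k.lt_succ_self), fun m' hm' => ?_⟩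
  obtain ⟨l, hl, hl'⟩ := exists_block_mem hj0 hj m'
  have hlk : l < k := hj.lt_iff_lt.mp (hl.trans_lt hm')
  exact ⟨i l, (hi hlk).trans_le hk,
    stutterEquiv_suffix hi hj h le_rfl (hi l.lt_succ_self) hl hl'⟩

theorem LTL.Sat.until_of_stutterEquiv {φ ψ : LTL P}
    (hφ : ∀ σ σ' : ℕ → Set P, StutterEquiv σ σ' → (φ.Sat σ ↔ φ.Sat σ'))
    (hψ : ∀ σ σ' : ℕ → Set P, StutterEquiv σ σ' → (ψ.Sat σ ↔ ψ.Sat σ'))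
    {σ σ' : ℕ → Set P} (h : StutterEquiv σ σ') (hσ : (LTL.until_ φ ψ).Sat σ) :
    (LTL.until_ φ ψ).Sat σ' := by
  obtain ⟨n, hn, hlt⟩ := hσ
  obtain ⟨n', hn', hlt'⟩ := h.exists_match n
  refine ⟨n', (hψ _ _ hn').mp hn, fun m' hm' => ?_⟩
  obtain ⟨m, hm, hmm'⟩ := hlt' m' hm'
  exact (hφ _ _ hmm').mp (hlt m hm)

/-- Stutter-equivalent traces satisfy the same next-free LTL formulas. -/
theorem ltl_stutter_invariant (σ σ' : ℕ → Set P) (φ : LTL P)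
    (h : StutterEquiv σ σ') : LTL.Sat φ σ ↔ LTL.Sat φ σ' := by
  induction φ generalizing σ σ' with
  | atom p => simp only [LTL.Sat, h.apply_zero]
  | tt => rfl
  | neg φ ih => exact not_congr (ih σ σ' h)
  | and φ ψ ihφ ihψ => exact and_congr (ihφ σ σ' h) (ihψ σ σ' h)
  | until_ φ ψ ihφ ihψ =>
    exact ⟨LTL.Sat.until_of_stutterEquiv ihφ ihψ h,
      LTL.Sat.until_of_stutterEquiv ihφ ihψ h.symm⟩

end
end
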